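/- Let m>1, 0<p<1 with m+p<2, and let σ>2(1−p)/(m−1). Then there exists no good profile f which either has an interface at some ξ₀∈(0,∞), or is positive on all of (0,∞) with f(ξ)→0 as ξ→∞ (no good blow-up profiles exist, with or without interface). -/

import Mathlib

open Real Filter Set Topology

/-- The function `f^m` (real power). -/
noncomputable def Fm (m : ℝ) (f : ℝ → ℝ) : ℝ → ℝ := fun ξ => f ξ ^ m

/-- `f` solves the self-similar profile ODE
`(f^m)'' - α f + β ξ f' + ξ^σ f^p = 0` on the set `S`. -/
noncomputable def SolvesODE (m p σ α β : ℝ) (f : ℝ → ℝ) (S : Set ℝ) : Prop :=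
  ∀ ξ ∈ S,
    deriv (deriv (Fm m f)) ξ - α * f ξ + β * ξ * deriv f ξ + ξ ^ σ * f ξ ^ p = 0

/-- A profile: continuous and nonnegative on `[0,∞)`, with `f^m` of class `C²`
on the (positive-space) positivity set, solving the profile ODE there. -/
noncomputable def IsProfile (m p σ α β : ℝ) (f : ℝ → ℝ) : Prop :=
  ContinuousOn f (Set.Ici 0) ∧ (∀ ξ ∈ Set.Ici (0 : ℝ), 0 ≤ f ξ) ∧
    ContDiffOn ℝ 2 (Fm m f) {ξ : ℝ | 0 < ξ ∧ 0 < f ξ} ∧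
    SolvesODE m p σ α β f {ξ : ℝ | 0 < ξ ∧ 0 < f ξ}

/-- Behavior (P1) at the origin: `f(0) = a > 0`, `f'(0) = 0`. -/
noncomputable def GoodP1 (f : ℝ → ℝ) : Prop :=
  0 < f 0 ∧ HasDerivWithinAt f 0 (Set.Ici 0) 0

/-- Behavior (P2) at the origin: `f(0) = 0`, `(f^m)'(0) = 0`. -/
noncomputable def GoodP2 (m : ℝ) (f : ℝ → ℝ) : Prop :=
  f 0 = 0 ∧ HasDerivWithinAt (Fm m f) 0 (Set.Ici 0) 0

/-- `f` has an interface at `ξ₀ ∈ (0,∞)`: `f(ξ₀) = 0`, `(f^m)'(ξ₀) = 0`, and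
`f > 0` on a left-neighborhood of `ξ₀`. -/
noncomputable def HasInterface (m : ℝ) (f : ℝ → ℝ) (ξ₀ : ℝ) : Prop :=
  0 < ξ₀ ∧ f ξ₀ = 0 ∧ HasDerivAt (Fm m f) 0 ξ₀ ∧
    ∃ δ > 0, ∀ ξ ∈ Set.Ioo (ξ₀ - δ) ξ₀, 0 < f ξ

/-- Type I interface behavior at `ξ₀`: `f(ξ)(ξ₀-ξ)^{-1/(m-1)}` has a finite
positive limit as `ξ → ξ₀⁻`. -/
noncomputable def TypeI (m : ℝ) (f : ℝ → ℝ) (ξ₀ : ℝ) : Prop :=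
  ∃ L > 0, Filter.Tendsto (fun ξ => f ξ * (ξ₀ - ξ) ^ (-(1 / (m - 1))))
    (nhdsWithin ξ₀ (Set.Iio ξ₀)) (nhds L)

/-- Type II interface behavior at `ξ₀`: `f(ξ)(ξ₀-ξ)^{-1/(1-p)}` has a finite
positive limit as `ξ → ξ₀⁻`. -/
noncomputable def TypeII (p : ℝ) (f : ℝ → ℝ) (ξ₀ : ℝ) : Prop :=
  ∃ L > 0, Filter.Tendsto (fun ξ => f ξ * (ξ₀ - ξ) ^ (-(1 / (1 - p))))
    (nhdsWithin ξ₀ (Set.Iio ξ₀)) (nhds L)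

/-- The flux `(f^m)' + β ξ f` of the profile equation. -/
noncomputable def flux (m β : ℝ) (f : ℝ → ℝ) (ξ : ℝ) : ℝ :=
  deriv (Fm m f) ξ + β * ξ * f ξ

lemma le_of_hasDerivAt_nonpos {F F' : ℝ → ℝ} {x y : ℝ} (hxy : x ≤ y)
    (hF : ∀ t ∈ Icc x y, HasDerivAt F (F' t) t) (hF' : ∀ t ∈ Icc x y, F' t ≤ 0) : F y ≤ F x := by
  refine antitoneOn_of_deriv_nonpos (convex_Icc x y)
    (fun t ht => (hF t ht).continuousAt.continuousWithinAt)
    (fun t ht => (hF t (interior_subset ht)).differentiableAt.differentiableWithinAt)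
    (fun t ht => ?_) (left_mem_Icc.2 hxy) (right_mem_Icc.2 hxy) hxy
  rw [(hF t (interior_subset ht)).deriv]
  exact hF' t (interior_subset ht)

lemma lt_of_hasDerivAt_neg {F F' : ℝ → ℝ} {x y : ℝ} (hxy : x < y)
    (hF : ∀ t ∈ Icc x y, HasDerivAt F (F' t) t) (hF' : ∀ t ∈ Icc x y, F' t < 0) : F y < F x := by
  refine strictAntiOn_of_deriv_neg (convex_Icc x y)
    (fun t ht => (hF t ht).continuousAt.continuousWithinAt)
    (fun t ht => ?_) (left_mem_Icc.2 hxy.le) (right_mem_Icc.2 hxy.le) hxy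
  rw [(hF t (interior_subset ht)).deriv]
  exact hF' t (interior_subset ht)

section Profile

variable {m p σ α β : ℝ} {f : ℝ → ℝ}

lemma IsProfile.hasDerivAt (h : IsProfile m p σ α β f) (hm : 0 < m) {ξ : ℝ} (hξ : 0 < ξ)
    (hf : 0 < f ξ) :
    HasDerivAt (Fm m f) (deriv (Fm m f) ξ) ξ ∧
      HasDerivAt (deriv (Fm m f)) (deriv (deriv (Fm m f)) ξ) ξ ∧
      HasDerivAt f (deriv f ξ) ξ ∧ deriv (Fm m f) ξ = deriv f ξ * m * f ξ ^ (m - 1) := by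
  obtain ⟨hc, -, hC2, -⟩ := h
  have hopen : IsOpen {ξ : ℝ | 0 < ξ ∧ 0 < f ξ} :=
    (hc.mono Ioi_subset_Ici_self).isOpen_inter_preimage isOpen_Ioi isOpen_Ioi
  have hnhds : {ξ : ℝ | 0 < ξ ∧ 0 < f ξ} ∈ 𝓝 ξ := hopen.mem_nhds ⟨hξ, hf⟩
  have hg : DifferentiableAt ℝ (Fm m f) ξ :=
    (hC2.contDiffAt hnhds).differentiableAt (by norm_num)
  have hg' : DifferentiableAt ℝ (deriv (Fm m f)) ξ := by
    have h1 : ContDiffOn ℝ 1 (deriv (Fm m f)) {ξ : ℝ | 0 < ξ ∧ 0 < f ξ} :=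
      hC2.deriv_of_isOpen hopen (by norm_num)
    exact (h1.contDiffAt hnhds).differentiableAt (by norm_num)
  have hfd : DifferentiableAt ℝ f ξ := by
    have hne : Fm m f ξ ≠ 0 := (rpow_pos_of_pos hf m).ne'
    have h2 := hg.hasDerivAt.rpow_const (p := m⁻¹) (Or.inl hne)
    refine h2.differentiableAt.congr_of_eventuallyEq ?_
    filter_upwards [hnhds] with x hx
    exact (rpow_rpow_inv hx.2.le hm.ne').symm
  exact ⟨hg.hasDerivAt, hg'.hasDerivAt, hfd.hasDerivAt,
    (hfd.hasDerivAt.rpow_const (Or.inl hf.ne')).deriv⟩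

lemma IsProfile.hasDerivAt_flux (h : IsProfile m p σ α β f) (hm : 0 < m) {ξ : ℝ} (hξ : 0 < ξ)
    (hf : 0 < f ξ) :
    HasDerivAt (flux m β f) ((α + β) * f ξ - ξ ^ σ * f ξ ^ p) ξ := by
  obtain ⟨-, h2, h3, -⟩ := h.hasDerivAt hm hξ hf
  have hode := h.2.2.2 ξ ⟨hξ, hf⟩
  refine (h2.add (((hasDerivAt_id ξ).const_mul β).mul h3)).congr_deriv ?_
  simp only [id]
  linarith

/-- The set `S` lies in the positivity set and the source term dominates on it. -/
def SourceDominates (p σ α β : ℝ) (f : ℝ → ℝ) (S : Set ℝ) : Prop :=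
  ∀ ξ ∈ S, 0 < ξ ∧ 0 < f ξ ∧ (α + β) * f ξ ≤ 1 / 2 * (ξ ^ σ * f ξ ^ p)

lemma SourceDominates.mono {S T : Set ℝ} (h : SourceDominates p σ α β f S) (hTS : T ⊆ S) :
    SourceDominates p σ α β f T :=
  fun ξ hξ => h ξ (hTS hξ)

lemma eventually_source_dominates {l : Filter ℝ} {c A : ℝ} (hp1 : p < 1) (hc : 0 < c)
    (hlim : Tendsto f l (𝓝 0)) (hpos : ∀ᶠ ξ in l, 0 < f ξ) (hξ : ∀ᶠ ξ in l, c ≤ ξ ^ σ) :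
    ∀ᶠ ξ in l, A * f ξ ≤ 1 / 2 * (ξ ^ σ * f ξ ^ p) := by
  have h1 : Tendsto (fun ξ => A * f ξ ^ (1 - p)) l (𝓝 0) := by
    have := (hlim.rpow_const (p := 1 - p) (Or.inr (by linarith))).const_mul A
    rwa [zero_rpow (by linarith), mul_zero] at this
  filter_upwards [h1.eventually_lt_const (half_pos hc), hpos, hξ] with ξ h1 h2 h3
  have h4 : f ξ = f ξ ^ (1 - p) * f ξ ^ p := by
    rw [← rpow_add h2, sub_add_cancel, rpow_one]
  have h5 : 0 < f ξ ^ p := rpow_pos_of_pos h2 p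
  calc A * f ξ = A * f ξ ^ (1 - p) * f ξ ^ p := by rw [mul_assoc, ← h4]
    _ ≤ ξ ^ σ / 2 * f ξ ^ p := by gcongr; linarith
    _ = _ := by ring

/-- Past a point where `f` has decreased, `f^m` keeps decreasing: every critical point is a strict
local maximum. -/
lemma IsProfile.deriv_nonpos (h : IsProfile m p σ α β f) (hm : 0 < m) (hβ : 0 < β) {S : Set ℝ}
    (hS : S.OrdConnected) (hdom : SourceDominates p σ α β f S) {x₁ x₂ x : ℝ} (hx₁ : x₁ ∈ S)
    (hx₂ : x₂ ∈ S) (h12 : x₁ < x₂) (hlt : f x₂ < f x₁) (hx : x ∈ S) (h2x : x₂ ≤ x) :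
    deriv (Fm m f) x ≤ 0 := by
  have hd : ∀ t ∈ S, _ := fun t ht => h.hasDerivAt hm (hdom t ht).1 (hdom t ht).2.1
  have hsub : Icc x₁ x ⊆ S := hS.out hx₁ hx
  obtain ⟨c, hc, hcslope⟩ := exists_deriv_eq_slope (Fm m f) h12
    (fun t ht => (hd t (hS.out hx₁ hx₂ ht)).1.continuousAt.continuousWithinAt)
    (fun t ht => (hd t (hS.out hx₁ hx₂
      (Ioo_subset_Icc_self ht))).1.differentiableAt.differentiableWithinAt)
  have hcS : Icc c x ⊆ S := (Icc_subset_Icc_left hc.1.le).trans hsub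
  have hcneg : deriv (Fm m f) c ≤ 0 := by
    rw [hcslope]
    have : Fm m f x₂ < Fm m f x₁ := rpow_lt_rpow (hdom x₂ hx₂).2.1.le hlt hm
    exact div_nonpos_of_nonpos_of_nonneg (by linarith) (by linarith)
  refine image_le_of_deriv_right_lt_deriv_boundary' (B := fun _ => 0) (B' := fun _ => 0)
    (fun t ht => (hd t (hcS ht)).2.1.continuousAt.continuousWithinAt)
    (fun t ht => (hd t (hcS (Ico_subset_Icc_self ht))).2.1.hasDerivWithinAt)
    hcneg continuousOn_const (fun t _ => hasDerivWithinAt_const t _ 0) (fun t ht h0 => ?_)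
    (right_mem_Icc.2 (hc.2.le.trans h2x))
  have htS := hcS (Ico_subset_Icc_self ht)
  obtain ⟨ht0, hft, hs⟩ := hdom t htS
  have hode := h.2.2.2 t ⟨ht0, hft⟩
  have hf' : deriv f t = 0 := by
    have h4 := (hd t htS).2.2.2
    rw [h0] at h4
    have h5 := rpow_pos_of_pos hft (m - 1)
    rcases mul_eq_zero.1 h4.symm with h6 | h6
    · exact (mul_eq_zero.1 h6).resolve_right hm.ne'
    · exact absurd h6 h5.ne'
  rw [hf'] at hode
  have h6 : 0 < t ^ σ * f t ^ p := mul_pos (rpow_pos_of_pos ht0 σ) (rpow_pos_of_pos hft p)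
  nlinarith [mul_pos hβ hft]

/-- Once the flux is nonpositive, `f^m` decreases at least linearly. -/
lemma IsProfile.linear_decay_of_flux_nonpos (h : IsProfile m p σ α β f) (hm : 0 < m) (hβ : 0 < β)
    {S : Set ℝ} (hS : S.OrdConnected) (hdom : SourceDominates p σ α β f S) {x₁ x₂ : ℝ}
    (hx₁ : x₁ ∈ S) (hx₂ : x₂ ∈ S) (h12 : x₁ < x₂) (hflux : flux m β f x₁ ≤ 0) :
    ∃ η > 0, ∀ y ∈ S, x₂ ≤ y → ∀ x ∈ Icc x₂ y, Fm m f y + η * (y - x) ≤ Fm m f x := by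
  have hneg : ∀ t ∈ S, (α + β) * f t - t ^ σ * f t ^ p < 0 := fun t ht => by
    obtain ⟨ht0, hft, hs⟩ := hdom t ht
    have : 0 < t ^ σ * f t ^ p := mul_pos (rpow_pos_of_pos ht0 σ) (rpow_pos_of_pos hft p)
    linarith
  have hd : ∀ t ∈ S, _ := fun t ht => h.hasDerivAt_flux hm (hdom t ht).1 (hdom t ht).2.1
  have h2 : flux m β f x₂ < 0 := lt_of_lt_of_le
    (lt_of_hasDerivAt_neg h12 (fun t ht => hd t (hS.out hx₁ hx₂ ht))
      (fun t ht => hneg t (hS.out hx₁ hx₂ ht))) hflux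
  refine ⟨-flux m β f x₂, by linarith, fun y hy h2y x hx => ?_⟩
  have hsub : Icc x₂ y ⊆ S := hS.out hx₂ hy
  have key := le_of_hasDerivAt_nonpos (F := fun t => Fm m f t + -flux m β f x₂ * t) hx.2
    (fun t ht => by
      have htS := hsub ⟨hx.1.trans ht.1, ht.2⟩
      exact (h.hasDerivAt hm (hdom t htS).1 (hdom t htS).2.1).1.add
        ((hasDerivAt_id t).const_mul (-flux m β f x₂)))
    (fun t ht => by
      have htS := hsub ⟨hx.1.trans ht.1, ht.2⟩
      have h3 : flux m β f t ≤ flux m β f x₂ :=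
        le_of_hasDerivAt_nonpos (hx.1.trans ht.1)
          (fun r hr => hd r (hsub ⟨hr.1, hr.2.trans ht.2⟩))
          (fun r hr => (hneg r (hsub ⟨hr.1, hr.2.trans ht.2⟩)).le)
      have h4 : 0 < β * t * f t := mul_pos (mul_pos hβ (hdom t htS).1) (hdom t htS).2.1
      have h5 : flux m β f t = deriv (Fm m f) t + β * t * f t := rfl
      linarith)
  linarith

/-- Differential inequality for the power `1 - p` of the flux along decreasing positive arcs. -/
lemma IsProfile.hasDerivAt_flux_rpow_le (h : IsProfile m p σ α β f) (hm : 0 < m) (hβ : 0 < β)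
    (hp0 : 0 < p) (hp1 : p < 1) {ξ : ℝ} (hξ : 0 < ξ) (hf : 0 < f ξ)
    (hs : (α + β) * f ξ ≤ 1 / 2 * (ξ ^ σ * f ξ ^ p)) (hflux : 0 < flux m β f ξ)
    (hg : deriv (Fm m f) ξ ≤ 0) :
    ∃ d, HasDerivAt (fun t => flux m β f t ^ (1 - p)) d ξ ∧
      d ≤ -((1 - p) / 2 * ξ ^ σ * (β * ξ) ^ (-p)) := by
  refine ⟨_, (h.hasDerivAt_flux hm hξ hf).rpow_const (Or.inl hflux.ne'), ?_⟩
  set w := flux m β f ξ with hw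
  have hβξ : 0 < β * ξ := mul_pos hβ hξ
  have h1 : w ≤ β * ξ * f ξ := by simp only [hw, flux]; linarith
  have hσ : 0 < ξ ^ σ := rpow_pos_of_pos hξ σ
  have h2 : (β * ξ) ^ (-p) ≤ f ξ ^ p * w ^ (-p) := by
    have h3 : w ^ p ≤ (β * ξ) ^ p * f ξ ^ p := by
      rw [← mul_rpow hβξ.le hf.le]
      exact rpow_le_rpow hflux.le h1 hp0.le
    rw [rpow_neg hβξ.le, rpow_neg hflux.le, ← div_eq_mul_inv, le_div_iff₀ (rpow_pos_of_pos hflux p),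
      inv_mul_le_iff₀ (rpow_pos_of_pos hβξ p)]
    exact h3
  have hexp : 1 - p - 1 = -p := by ring
  have h4 : 0 < w ^ (-p) := rpow_pos_of_pos hflux _
  rw [hexp]
  calc ((α + β) * f ξ - ξ ^ σ * f ξ ^ p) * (1 - p) * w ^ (-p)
      ≤ (-(1 / 2 * (ξ ^ σ * f ξ ^ p))) * (1 - p) * w ^ (-p) := by
        have : 0 ≤ 1 - p := by linarith
        gcongr
        linarith
    _ = -((1 - p) / 2 * ξ ^ σ * (f ξ ^ p * w ^ (-p))) := by ring
    _ ≤ _ := by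
        have : 0 ≤ (1 - p) / 2 * ξ ^ σ := mul_nonneg (by linarith) hσ.le
        exact neg_le_neg (mul_le_mul_of_nonneg_left h2 this)

/-- A positive flux forces an at most linear growth of `f^(m-1)` to the left of a point. -/
lemma IsProfile.rpow_le_of_flux_pos (h : IsProfile m p σ α β f) (hm : 1 < m) (hβ : 0 < β)
    {x y b : ℝ} (hxy : x ≤ y) (hyb : y ≤ b)
    (hpos : ∀ t ∈ Icc x y, 0 < t ∧ 0 < f t ∧ 0 < flux m β f t) :
    f x ^ (m - 1) ≤ f y ^ (m - 1) + (m - 1) / m * β * b * (y - x) := by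
  have hm0 : 0 < m := by linarith
  have key := le_of_hasDerivAt_nonpos
    (F := fun t => -(f t ^ (m - 1)) + -((m - 1) / m * β * b) * t) hxy
    (fun t ht => by
      obtain ⟨ht0, hft, -⟩ := hpos t ht
      exact ((h.hasDerivAt hm0 ht0 hft).2.2.1.rpow_const (p := m - 1) (Or.inl hft.ne')).neg.add
        ((hasDerivAt_id t).const_mul (-((m - 1) / m * β * b))))
    (fun t ht => by
      obtain ⟨ht0, hft, hfl⟩ := hpos t ht
      have h4 := (h.hasDerivAt hm0 ht0 hft).2.2.2
      have h5 : f t ^ (m - 1) = f t ^ (m - 1 - 1) * f t := by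
        rw [← rpow_add_one hft.ne', sub_add_cancel]
      have h6 : 0 < f t * (deriv f t * m * f t ^ (m - 1 - 1) + β * t) := by
        simp only [flux] at hfl
        rw [h4, h5] at hfl
        linarith
      have h7 := pos_of_mul_pos_right h6 hft.le
      have h8 : (m - 1) / m * (deriv f t * m * f t ^ (m - 1 - 1)) =
          deriv f t * (m - 1) * f t ^ (m - 1 - 1) := by
        field_simp
      have h9 : 0 < (m - 1) / m := div_pos (by linarith) hm0
      have h10 : β * t ≤ β * b := by gcongr; exact ht.2.trans hyb
      rw [← h8]
      nlinarith)
  linarith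

lemma IsProfile.flux_rpow_antitone_bound (h : IsProfile m p σ α β f) (hm : 0 < m) (hβ : 0 < β)
    (hp0 : 0 < p) (hp1 : p < 1) {G G' : ℝ → ℝ} {x y : ℝ} (hxy : x ≤ y)
    (hdom : SourceDominates p σ α β f (Icc x y))
    (hpos : ∀ t ∈ Icc x y, 0 < flux m β f t ∧ deriv (Fm m f) t ≤ 0)
    (hG : ∀ t ∈ Icc x y, HasDerivAt G (G' t) t)
    (hG' : ∀ t ∈ Icc x y, G' t ≤ (1 - p) / 2 * t ^ σ * (β * t) ^ (-p)) :
    G y - G x ≤ flux m β f x ^ (1 - p) := by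
  have hd : ∀ t : ℝ, ∃ d, t ∈ Icc x y → HasDerivAt (fun t => flux m β f t ^ (1 - p)) d t ∧
      d ≤ -((1 - p) / 2 * t ^ σ * (β * t) ^ (-p)) := fun t => by
    by_cases ht : t ∈ Icc x y
    · obtain ⟨h1, h2, h3⟩ := hdom t ht
      obtain ⟨d, hd⟩ := h.hasDerivAt_flux_rpow_le hm hβ hp0 hp1 h1 h2 h3 (hpos t ht).1 (hpos t ht).2
      exact ⟨d, fun _ => hd⟩
    · exact ⟨0, fun h => absurd h ht⟩
  choose d hd using hd
  have key := le_of_hasDerivAt_nonpos (F := fun t => flux m β f t ^ (1 - p) + G t) hxy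
    (fun t ht => (hd t ht).1.add (hG t ht))
    (fun t ht => by linarith [(hd t ht).2, hG' t ht])
  have : 0 < flux m β f y ^ (1 - p) := rpow_pos_of_pos (hpos y (right_mem_Icc.2 hxy)).1 _
  linarith

lemma IsProfile.not_tendsto_zero_atTop (h : IsProfile m p σ α β f) (hm : 0 < m) (hβ : 0 < β)
    (hp0 : 0 < p) (hp1 : p < 1) (hσ : 0 < σ) (hpos : ∀ ξ : ℝ, 0 < ξ → 0 < f ξ) :
    ¬ Tendsto f atTop (𝓝 0) := by
  intro hlim
  have hev := eventually_source_dominates (σ := σ) (A := α + β) hp1 one_pos hlim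
    ((eventually_gt_atTop 0).mono hpos)
    ((eventually_ge_atTop 1).mono fun ξ hξ => one_le_rpow hξ hσ.le)
  obtain ⟨a, ha⟩ := eventually_atTop.1 (hev.and (eventually_ge_atTop 1))
  have ha1 : 1 ≤ a := (ha a le_rfl).2
  have hdom : SourceDominates p σ α β f (Ici a) := fun ξ hξ =>
    ⟨by linarith [(ha ξ hξ).2], hpos ξ (by linarith [(ha ξ hξ).2]), (ha ξ hξ).1⟩
  have hflux : ∀ x ∈ Ici a, 0 < flux m β f x := by
    intro x hx
    by_contra! hneg
    have hx' : x + 1 ∈ Ici a := by simp only [mem_Ici] at hx ⊢; linarith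
    obtain ⟨η, hη, hdec⟩ := h.linear_decay_of_flux_nonpos hm hβ ordConnected_Ici hdom hx
      hx' (by linarith) hneg
    set y := x + 1 + Fm m f (x + 1) / η with hy
    have hF : 0 < Fm m f (x + 1) := rpow_pos_of_pos (hdom _ hx').2.1 m
    have hxy : x + 1 ≤ y := by have := div_pos hF hη; linarith
    have hyS : y ∈ Ici a := by simp only [mem_Ici] at hx' ⊢; linarith
    have := hdec y hyS hxy (x + 1) ⟨le_rfl, hxy⟩
    have hFy : 0 < Fm m f y := rpow_pos_of_pos (hdom y hyS).2.1 m
    have h1 : η * (y - (x + 1)) = Fm m f (x + 1) := by rw [hy]; field_simp; ring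
    linarith
  obtain ⟨b, hb1, hb2⟩ := ((hlim.eventually_lt_const (hdom a (mem_Ici.2 le_rfl)).2.1).and
    (eventually_gt_atTop a)).exists
  have hg : ∀ x, b ≤ x → deriv (Fm m f) x ≤ 0 := fun x hx =>
    h.deriv_nonpos hm hβ ordConnected_Ici hdom (mem_Ici.2 le_rfl) hb2.le hb2 hb1
      (hb2.le.trans hx) hx
  set K := (1 - p) / 2 * β ^ (-p) with hK
  have hK0 : 0 < K := mul_pos (by linarith) (rpow_pos_of_pos hβ _)
  have hbound : ∀ y, b ≤ y → K * log y - K * log b ≤ flux m β f b ^ (1 - p) := fun y hy => by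
    have hIcc : Icc b y ⊆ Ici a := fun t ht => hb2.le.trans ht.1
    refine h.flux_rpow_antitone_bound hm hβ hp0 hp1 (G := fun t => K * log t)
      (G' := fun t => K * t⁻¹) hy (hdom.mono hIcc)
      (fun t ht => ⟨hflux t (hIcc ht), hg t ht.1⟩)
      (fun t ht => (hasDerivAt_log (hdom t (hIcc ht)).1.ne').const_mul K) (fun t ht => ?_)
    have ht0 := (hdom t (hIcc ht)).1
    have ht1 : 1 ≤ t := ha1.trans (hIcc ht)
    have h1 : t⁻¹ ≤ t ^ σ * t ^ (-p) := by
      rw [← rpow_add ht0, ← rpow_neg_one]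
      exact rpow_le_rpow_of_exponent_le ht1 (by linarith)
    calc K * t⁻¹ ≤ K * (t ^ σ * t ^ (-p)) := by gcongr
      _ = _ := by rw [hK, mul_rpow hβ.le ht0.le]; ring
  obtain ⟨y, hy1, hy2⟩ := ((tendsto_log_atTop.const_mul_atTop hK0).eventually_gt_atTop
    (flux m β f b ^ (1 - p) + K * log b) |>.and (eventually_ge_atTop b)).exists
  linarith [hbound y hy2]

lemma IsProfile.not_hasInterface (h : IsProfile m p σ α β f) (hm : 1 < m) (hβ : 0 < β)
    (hp0 : 0 < p) (hp1 : p < 1) (hmp : m + p < 2) (hσ : 0 < σ) (ξ₀ : ℝ) :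
    ¬ HasInterface m f ξ₀ := by
  rintro ⟨hξ₀, hf0, hF0, δ, hδ, hfpos⟩
  have hm0 : 0 < m := by linarith
  have hlim : Tendsto f (𝓝[<] ξ₀) (𝓝 0) := by
    have := (h.1.continuousAt (Ici_mem_nhds hξ₀)).tendsto
    rw [hf0] at this
    exact this.mono_left nhdsWithin_le_nhds
  have hIoo : ∀ᶠ ξ in 𝓝[<] ξ₀, ξ ∈ Ioo (max (ξ₀ - δ) (ξ₀ / 2)) ξ₀ :=
    Ioo_mem_nhdsLT (max_lt (by linarith) (by linarith))
  have hhalf : 0 < ξ₀ / 2 := by linarith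
  have hev := eventually_source_dominates (σ := σ) (A := α + β) hp1 (rpow_pos_of_pos hhalf σ) hlim
    (hIoo.mono fun ξ hξ => hfpos ξ ⟨(max_lt_iff.1 hξ.1).1, hξ.2⟩)
    (hIoo.mono fun ξ hξ => rpow_le_rpow hhalf.le (max_lt_iff.1 hξ.1).2.le hσ.le)
  obtain ⟨a, haξ, ha⟩ := (mem_nhdsLT_iff_exists_Ioo_subset).1 (hev.and hIoo)
  have haξ : a < ξ₀ := haξ
  have hlow : ∀ ξ ∈ Ioo a ξ₀, ξ₀ / 2 ≤ ξ := fun ξ hξ => (max_lt_iff.1 (ha hξ).2.1).2.le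
  have hdom : SourceDominates p σ α β f (Ioo a ξ₀) := fun ξ hξ =>
    ⟨hhalf.trans_le (hlow ξ hξ), hfpos ξ ⟨(max_lt_iff.1 (ha hξ).2.1).1, hξ.2⟩, (ha hξ).1⟩
  have hmem : ∀ {b : ℝ}, b < ξ₀ → ∀ᶠ y in 𝓝[<] ξ₀, y ∈ Ioo b ξ₀ := fun hb => Ioo_mem_nhdsLT hb
  have hFlim : Tendsto (Fm m f) (𝓝[<] ξ₀) (𝓝 0) := by
    have := hlim.rpow_const (p := m) (Or.inr hm0.le)
    rwa [zero_rpow hm0.ne'] at this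
  have hFξ₀ : Fm m f ξ₀ = 0 := by simp only [Fm, hf0, zero_rpow hm0.ne']
  have hid : Tendsto (fun y : ℝ => y) (𝓝[<] ξ₀) (𝓝 ξ₀) := nhdsWithin_le_nhds
  have hflux : ∀ x ∈ Ioo a ξ₀, 0 < flux m β f x := by
    intro x hx
    by_contra! hneg
    obtain ⟨x₂, hx2⟩ := exists_between hx.2
    obtain ⟨η, hη, hdec⟩ := h.linear_decay_of_flux_nonpos hm0 hβ ordConnected_Ioo hdom hx
      ⟨hx.1.trans hx2.1, hx2.2⟩ hx2.1 hneg
    have hlin : ∀ z ∈ Ico x₂ ξ₀, η * (ξ₀ - z) ≤ Fm m f z := fun z hz => by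
      have h1 : Tendsto (fun y => Fm m f y + η * (y - z)) (𝓝[<] ξ₀) (𝓝 (0 + η * (ξ₀ - z))) :=
        hFlim.add ((hid.sub_const z).const_mul η)
      rw [zero_add] at h1
      refine le_of_tendsto h1 ((hmem hz.2).mono fun y hy => ?_)
      exact hdec y ⟨(hx.1.trans hx2.1).trans_le (hz.1.trans hy.1.le), hy.2⟩
        (hz.1.trans hy.1.le) z ⟨hz.1, hy.1.le⟩
    have hslope : Tendsto (slope (Fm m f) ξ₀) (𝓝[<] ξ₀) (𝓝 0) :=
      (hasDerivAt_iff_tendsto_slope.1 hF0).mono_left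
      (nhdsWithin_mono ξ₀ (fun y (hy : y < ξ₀) => hy.ne : Iio ξ₀ ⊆ {ξ₀}ᶜ))
    have : (0 : ℝ) ≤ -η := le_of_tendsto hslope ((hmem hx2.2).mono fun y hy => by
      rw [slope_def_field, hFξ₀, sub_zero, div_le_iff_of_neg (by linarith [hy.2])]
      linarith [hlin y ⟨hy.1.le, hy.2⟩])
    linarith
  obtain ⟨x₁, hx₁⟩ := exists_between haξ
  obtain ⟨b, hb1, hb2⟩ := ((hlim.eventually_lt_const (hdom x₁ hx₁).2.1).and
    (hmem hx₁.2)).exists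
  have hbS : b ∈ Ioo a ξ₀ := ⟨hx₁.1.trans hb2.1, hb2.2⟩
  have hg : ∀ x ∈ Ico b ξ₀, deriv (Fm m f) x ≤ 0 := fun x hx =>
    h.deriv_nonpos hm0 hβ ordConnected_Ioo hdom hx₁ hbS hb2.1 hb1
      ⟨hbS.1.trans_le hx.1, hx.2⟩ hx.1
  set C := (m - 1) / m * β * ξ₀ with hC
  set c := (1 - p) / 2 * (ξ₀ / 2) ^ σ * (β * ξ₀) ^ (-p) with hc
  have hc0 : 0 < c := mul_pos (mul_pos (by linarith) (rpow_pos_of_pos hhalf σ))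
    (rpow_pos_of_pos (mul_pos hβ hξ₀) _)
  have hC0 : 0 < C := mul_pos (mul_pos (div_pos (by linarith) hm0) hβ) hξ₀
  have hupper : ∀ x ∈ Ico b ξ₀, f x ^ (m - 1) ≤ C * (ξ₀ - x) := fun x hx => by
    have h1 : Tendsto (fun y => f y ^ (m - 1) + C * (y - x)) (𝓝[<] ξ₀)
        (𝓝 (0 ^ (m - 1) + C * (ξ₀ - x))) :=
      (hlim.rpow_const (Or.inr (by linarith))).add ((hid.sub_const x).const_mul C)
    rw [zero_rpow (by linarith), zero_add] at h1
    refine ge_of_tendsto h1 ((hmem hx.2).mono fun y hy => ?_)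
    refine h.rpow_le_of_flux_pos hm hβ hy.1.le hy.2.le fun t ht => ?_
    have htS : t ∈ Ioo a ξ₀ := ⟨hbS.1.trans_le (hx.1.trans ht.1), ht.2.trans_lt hy.2⟩
    exact ⟨(hdom t htS).1, (hdom t htS).2.1, hflux t htS⟩
  have hlower : ∀ x ∈ Ico b ξ₀, c * (ξ₀ - x) ≤ (β * ξ₀) ^ (1 - p) * f x ^ (1 - p) :=
      fun x hx => by
    have hxS : x ∈ Ioo a ξ₀ := ⟨hbS.1.trans_le hx.1, hx.2⟩
    have h1 : c * (ξ₀ - x) ≤ flux m β f x ^ (1 - p) := by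
      have h2 : Tendsto (fun y => c * y - c * x) (𝓝[<] ξ₀) (𝓝 (c * ξ₀ - c * x)) :=
        (hid.const_mul c).sub_const _
      rw [mul_sub]
      refine le_of_tendsto h2 ((hmem hx.2).mono fun y hy => ?_)
      have hIcc : Icc x y ⊆ Ioo a ξ₀ := fun t ht => ⟨hxS.1.trans_le ht.1, ht.2.trans_lt hy.2⟩
      refine h.flux_rpow_antitone_bound hm0 hβ hp0 hp1 (G := fun t => c * t)
        (G' := fun _ => c * 1) hy.1.le (hdom.mono hIcc)
        (fun t ht => ⟨hflux t (hIcc ht), hg t ⟨hx.1.trans ht.1, (hIcc ht).2⟩⟩)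
        (fun t _ => (hasDerivAt_id t).const_mul c) (fun t ht => ?_)
      have ht0 := (hdom t (hIcc ht)).1
      have h3 : (ξ₀ / 2) ^ σ ≤ t ^ σ := rpow_le_rpow hhalf.le (hlow t (hIcc ht)) hσ.le
      have h4 : (β * ξ₀) ^ (-p) ≤ (β * t) ^ (-p) :=
        rpow_le_rpow_of_nonpos (mul_pos hβ ht0)
          (mul_le_mul_of_nonneg_left (hIcc ht).2.le hβ.le) (by linarith)
      have h5 : 0 ≤ (1 - p) / 2 := by linarith
      have h6 : 0 < (β * ξ₀) ^ (-p) := rpow_pos_of_pos (mul_pos hβ hξ₀) _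
      rw [mul_one, hc]
      gcongr
    refine h1.trans ?_
    have hfx := (hdom x hxS).2.1
    rw [← mul_rpow (mul_pos hβ hξ₀).le hfx.le]
    refine rpow_le_rpow (hflux x hxS).le ?_ (by linarith)
    have h7 : β * x * f x ≤ β * ξ₀ * f x := by gcongr; exact hx.2.le
    have h8 := hg x hx
    simp only [flux]
    linarith
  set M := C * (β * ξ₀) ^ (1 - p) with hM
  have hsmall : Tendsto (fun x => M * f x ^ (2 - m - p)) (𝓝[<] ξ₀) (𝓝 0) := by
    have := (hlim.rpow_const (p := 2 - m - p) (Or.inr (by linarith))).const_mul M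
    rwa [zero_rpow (by linarith), mul_zero] at this
  obtain ⟨x, hx1, hx2⟩ := ((hsmall.eventually_lt_const hc0).and (hmem hb2.2)).exists
  have hxI : x ∈ Ico b ξ₀ := ⟨hx2.1.le, hx2.2⟩
  have hfx : 0 < f x := (hdom x ⟨hbS.1.trans hx2.1, hx2.2⟩).2.1
  have hsplit : f x ^ (1 - p) = f x ^ (2 - m - p) * f x ^ (m - 1) := by
    rw [← rpow_add hfx]; congr 1; ring
  have h1 : c * f x ^ (m - 1) ≤ M * f x ^ (2 - m - p) * f x ^ (m - 1) := by
    calc c * f x ^ (m - 1) ≤ c * (C * (ξ₀ - x)) := by gcongr; exact hupper x hxI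
      _ = C * (c * (ξ₀ - x)) := by ring
      _ ≤ C * ((β * ξ₀) ^ (1 - p) * f x ^ (1 - p)) :=
        mul_le_mul_of_nonneg_left (hlower x hxI) hC0.le
      _ = _ := by rw [hsplit, hM]; ring
  linarith [le_of_mul_le_mul_right h1 (rpow_pos_of_pos hfx (m - 1))]

end Profile

/-- for `m+p<2` there are no good blow-up profiles, with or
without interface (no interface at any `ξ₀ ∈ (0,∞)`, and no everywhere-positive
profile decaying to `0` at infinity). -/
theorem nonexistence_good_profiles_subcritical (m p σ α β : ℝ)
    (hm : 1 < m) (hp0 : 0 < p) (hp1 : p < 1) (hmp : m + p < 2)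
    (hσ : 2 * (1 - p) / (m - 1) < σ)
    (hα : α = (σ + 2) / (σ * (m - 1) + 2 * (p - 1)))
    (hβ : β = (m - p) / (σ * (m - 1) + 2 * (p - 1))) :
    ¬ ∃ f : ℝ → ℝ,
        IsProfile m p σ α β f ∧ (GoodP1 f ∨ GoodP2 m f) ∧
        ((∃ ξ₀ : ℝ, HasInterface m f ξ₀) ∨
          ((∀ ξ : ℝ, 0 < ξ → 0 < f ξ) ∧
            Filter.Tendsto f Filter.atTop (nhds 0))) := by
  rintro ⟨f, hprof, -, hcases⟩
  have hm1 : 0 < m - 1 := by linarith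
  have hσ0 : 0 < σ := lt_of_le_of_lt (div_nonneg (by linarith) hm1.le) hσ
  have hβ0 : 0 < β := by
    rw [div_lt_iff₀ hm1] at hσ
    rw [hβ]
    exact div_pos (by linarith) (by linarith)
  rcases hcases with ⟨ξ₀, hint⟩ | ⟨hpos, hlim⟩
  · exact hprof.not_hasInterface hm hβ0 hp0 hp1 hmp hσ0 ξ₀ hint
  · exact hprof.not_tendsto_zero_atTop (by linarith) hβ0 hp0 hp1 hσ0 hpos hlim
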